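/- arXiv:1807.07569 — 2 statements merged into one kernel-verified Lean document; each statement's English description precedes it below -/
import Mathlib

section
/- Let x ∈ ℝ be a fixed real number and let N be a real-valued random variable with E[N] = 0 and E[N²] = σ² (σ > 0). Set Z = x + N. Then for any real constants a and b, E[ (Z − (a·Z + b))² ] + σ²·(2a − 1) = E[ (x − (a·Z + b))² ]. -/
open MeasureTheory

/-- scalar, constant-coefficient core identity for affine (first-order)
pixelwise denoisers: for `Z = x + N` with `E[N] = 0`, `E[N²] = σ²`,
`E[(Z − (aZ+b))²] + σ²(2a − 1) = E[(x − (aZ+b))²]`. -/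
theorem affine_scalar_unbiased
    {Ω : Type*} [MeasurableSpace Ω] (μ : Measure Ω) [IsProbabilityMeasure μ]
    (N : Ω → ℝ) (x σ a b : ℝ) (hσ : 0 < σ)
    (hNmeas : Measurable N)
    (hN2int : Integrable (fun ω => (N ω) ^ 2) μ)
    (hmean : ∫ ω, N ω ∂μ = 0)
    (hvar : ∫ ω, (N ω) ^ 2 ∂μ = σ ^ 2) :
    (∫ ω, ((x + N ω) - (a * (x + N ω) + b)) ^ 2 ∂μ) + σ ^ 2 * (2 * a - 1)
      = ∫ ω, (x - (a * (x + N ω) + b)) ^ 2 ∂μ := by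
  have hL : MemLp N 2 μ := (memLp_two_iff_integrable_sq hNmeas.aestronglyMeasurable).2 hN2int
  have hN : Integrable N μ := hL.integrable (by norm_num)
  have key : ∀ c d : ℝ, ∫ ω, (c + d * N ω) ^ 2 ∂μ = c ^ 2 + d ^ 2 * σ ^ 2 := by
    intro c d
    have h1 : ∀ ω, (c + d * N ω) ^ 2 = (c ^ 2 + (2 * c * d) * N ω) + d ^ 2 * (N ω) ^ 2 := by
      intro ω; ring
    simp_rw [h1]
    have i1 : Integrable (fun ω => (2 * c * d) * N ω) μ := hN.const_mul _
    have i2 : Integrable (fun ω => d ^ 2 * (N ω) ^ 2) μ := hN2int.const_mul _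
    have i3 : Integrable (fun _ : Ω => c ^ 2) μ := integrable_const _
    have i4 : Integrable (fun ω => c ^ 2 + (2 * c * d) * N ω) μ := i3.add i1
    rw [integral_add i4 i2, integral_add i3 i1, integral_const_mul, integral_const_mul,
      hmean, hvar]
    simp
  have e1 : ∀ ω, ((x + N ω) - (a * (x + N ω) + b)) ^ 2
      = ((x - a * x - b) + (1 - a) * N ω) ^ 2 := by intro ω; ring
  have e2 : ∀ ω, (x - (a * (x + N ω) + b)) ^ 2
      = ((x - a * x - b) + (-a) * N ω) ^ 2 := by intro ω; ring
  simp_rw [e1, e2]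
  rw [key, key]
  ring
end

section
/- Let x ∈ ℝ be a fixed real number and let N be a real-valued random variable with E[N] = 0, E[N²] = σ² (σ > 0), E[|N|³] < ∞, and E[N³] = 0. Set Z = x + N and, for real constants a₀, a₁, a₂, set X̂ = a₂·Z² + a₁·Z + a₀. Then E[ (Z − X̂)² + σ²·(2a₁ + 4a₂·Z − 1) ] = E[ (x − X̂)² ]. -/
open MeasureTheory

/-- scalar, constant-coefficient core identity for quadratic (second-order)
pixelwise denoisers: for `Z = x + N` with `E[N] = 0`, `E[N²] = σ²`, `E[|N|³] < ∞`,
`E[N³] = 0`, and `X̂ = a₂Z² + a₁Z + a₀`,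
`E[(Z − X̂)² + σ²(2a₁ + 4a₂Z − 1)] = E[(x − X̂)²]`. -/
theorem quadratic_scalar_unbiased
    {Ω : Type*} [MeasurableSpace Ω] (μ : Measure Ω) [IsProbabilityMeasure μ]
    (N : Ω → ℝ) (x σ a₀ a₁ a₂ : ℝ) (hσ : 0 < σ)
    (hNmeas : Measurable N)
    (hN2int : Integrable (fun ω => (N ω) ^ 2) μ)
    (hN3int : Integrable (fun ω => |N ω| ^ 3) μ)
    (hmean : ∫ ω, N ω ∂μ = 0)
    (hvar : ∫ ω, (N ω) ^ 2 ∂μ = σ ^ 2)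
    (hthird : ∫ ω, (N ω) ^ 3 ∂μ = 0)
    (Z : Ω → ℝ) (hZ : ∀ ω, Z ω = x + N ω)
    (Xhat : Ω → ℝ) (hXhat : ∀ ω, Xhat ω = a₂ * (Z ω) ^ 2 + a₁ * Z ω + a₀)
    (hint1 : Integrable (fun ω =>
      (Z ω - Xhat ω) ^ 2 + σ ^ 2 * (2 * a₁ + 4 * a₂ * Z ω - 1)) μ)
    (hint2 : Integrable (fun ω => (x - Xhat ω) ^ 2) μ) :
    ∫ ω, ((Z ω - Xhat ω) ^ 2 + σ ^ 2 * (2 * a₁ + 4 * a₂ * Z ω - 1)) ∂μ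
      = ∫ ω, (x - Xhat ω) ^ 2 ∂μ := by
  have h1 : Integrable N μ :=
    ((memLp_two_iff_integrable_sq hNmeas.aestronglyMeasurable).2 hN2int).integrable (by norm_num)
  have h3 : Integrable (fun ω => (N ω) ^ 3) μ := by
    refine hN3int.mono (hNmeas.pow_const 3).aestronglyMeasurable (Filter.Eventually.of_forall ?_)
    intro ω
    simp
  rw [← sub_eq_zero, ← integral_sub hint1 hint2]
  have e : ∀ ω, (Z ω - Xhat ω) ^ 2 + σ ^ 2 * (2 * a₁ + 4 * a₂ * Z ω - 1) - (x - Xhat ω) ^ 2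
      = (((2 * (x - a₂ * x ^ 2 - a₁ * x - a₀) + 4 * σ ^ 2 * a₂) * N ω
        + (1 - 4 * a₂ * x - 2 * a₁) * (N ω) ^ 2) + (-2 * a₂) * (N ω) ^ 3)
        + σ ^ 2 * (2 * a₁ + 4 * a₂ * x - 1) := by
    intro ω
    rw [hXhat, hZ]
    ring
  simp_rw [e]
  rw [integral_add (by fun_prop) (by fun_prop), integral_add (by fun_prop) (by fun_prop),
    integral_add (by fun_prop) (by fun_prop),
    integral_const_mul, integral_const_mul, integral_const_mul, hmean, hvar, hthird]
  simp
  ring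
end
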